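/- Let L be a C^k (k ≥ 2) Tonelli Lagrangian on T𝕋ⁿ without conjugate points. If an extremal curve c : ℝ → ℝⁿ satisfies c(b) = c(a) + r for some real numbers a < b and some r ∈ ℤⁿ, then c(s + (b−a)) = c(s) + r for all s ∈ ℝ. Consequently, the projection of every extremal curve to 𝕋ⁿ = ℝⁿ/ℤⁿ is either injective or periodic. -/

import Mathlib

open MeasureTheory
open scoped NNReal

noncomputable section

abbrev E (n : ℕ) : Type := Fin n → ℝ

/-- The vector of `ℝⁿ` whose coordinates are the integers `m i`. -/
def intVec {n : ℕ} (m : Fin n → ℤ) : E n := fun i => (m i : ℝ)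

/-- A Tonelli Lagrangian on `T𝕋ⁿ`, identified with a `ℤⁿ`-periodic (in `x`) function
on `ℝⁿ × ℝⁿ` which is `Cᵏ`, uniformly superlinear in `v` and with positive definite
fiberwise Hessian. -/
structure IsTonelliLagrangian (n : ℕ) (k : ℕ∞) (L : E n × E n → ℝ) : Prop where
  smooth : ContDiff ℝ k L
  periodic : ∀ (x v : E n) (m : Fin n → ℤ), L (x + intVec m, v) = L (x, v)
  superlinear : ∀ C : ℝ, ∃ R : ℝ, ∀ (x v : E n), R ≤ ‖v‖ → C * ‖v‖ ≤ L (x, v)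
  posdef : ∀ (x v w : E n), w ≠ 0 →
    0 < fderiv ℝ (fun v' => fderiv ℝ (fun v'' => L (x, v'')) v' w) v w

/-- Partial differential of `L` in the fiber (velocity) direction. -/
def partialV (n : ℕ) (L : E n × E n → ℝ) (x v : E n) : E n →L[ℝ] ℝ :=
  fderiv ℝ (fun v' => L (x, v')) v

/-- Partial differential of `L` in the base (position) direction. -/
def partialX (n : ℕ) (L : E n × E n → ℝ) (x v : E n) : E n →L[ℝ] ℝ :=
  fderiv ℝ (fun x' => L (x', v)) x

/-- A `C²` curve satisfying the Euler–Lagrange equation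
`d/dt (∂L/∂v(γ, γ')) = ∂L/∂x(γ, γ')`. -/
def IsExtremal (n : ℕ) (L : E n × E n → ℝ) (γ : ℝ → E n) : Prop :=
  ContDiff ℝ 2 γ ∧
  ∀ t : ℝ, HasDerivAt (fun s => partialV n L (γ s) (deriv γ s))
    (partialX n L (γ t) (deriv γ t)) t

/-- `φ` is the (complete, `C^{k-1}`) Euler–Lagrange flow of `L` on `ℝⁿ × ℝⁿ`:
`φ t (x,v) = (γ t, γ' t)` where `γ` is the extremal curve with `(γ 0, γ' 0) = (x, v)`. -/
def IsELFlow (n : ℕ) (k : ℕ) (L : E n × E n → ℝ)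
    (φ : ℝ → E n × E n → E n × E n) : Prop :=
  ContDiff ℝ ((k - 1 : ℕ) : ℕ∞) (fun p : ℝ × (E n × E n) => φ p.1 p.2) ∧
  (∀ z : E n × E n, φ 0 z = z) ∧
  ∀ x v : E n, IsExtremal n L (fun t => (φ t (x, v)).1) ∧
    ∀ t : ℝ, (φ t (x, v)).2 = deriv (fun s => (φ s (x, v)).1) t

/-- The flow `φ` has no conjugate points: for `t ≠ 0` the image of the vertical
subspace `{0} × ℝⁿ` under `Dφ_t(z)` meets `{0} × ℝⁿ` only in `0`. -/
def NoConjugatePoints (n : ℕ) (φ : ℝ → E n × E n → E n × E n) : Prop :=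
  ∀ (z : E n × E n) (t : ℝ), t ≠ 0 → ∀ w : E n,
    (fderiv ℝ (φ t) z (0, w)).1 = 0 → w = 0

/-- The absolutely continuous curve starting at `x` with derivative `g`. -/
def curveOf (n : ℕ) (x : E n) (g : ℝ → E n) : ℝ → E n :=
  fun s => x + ∫ u in (0:ℝ)..s, g u

/-- `Acost n L t x y` = the infimum of the Lagrangian action over all absolutely
continuous curves `c : [0,t] → ℝⁿ` with `c 0 = x` and `c t = y`. -/
def Acost (n : ℕ) (L : E n × E n → ℝ) (t : ℝ) (x y : E n) : ℝ :=
  sInf { A : ℝ | ∃ g : ℝ → E n,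
    IntervalIntegrable g volume 0 t ∧
    curveOf n x g t = y ∧
    IntervalIntegrable (fun s => L (curveOf n x g s, g s)) volume 0 t ∧
    A = ∫ s in (0:ℝ)..t, L (curveOf n x g s, g s) }

section

open Set Filter Topology

section

theorem hasFDerivAt_intervalIntegral_param {H F : Type*} [NormedAddCommGroup H] [NormedSpace ℝ H]
    [ProperSpace H] [NormedAddCommGroup F] [NormedSpace ℝ F] [CompleteSpace F]
    {f : ℝ × H → F} (hf : ContDiff ℝ 1 f) (a b : ℝ) (z : H) :
    HasFDerivAt (fun z => ∫ s in a..b, f (s, z))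
      (∫ s in a..b, (fderiv ℝ f (s, z)).comp (ContinuousLinearMap.inr ℝ ℝ H)) z := by
  have hfd : Continuous (fderiv ℝ f) := hf.continuous_fderiv one_ne_zero
  have hF' : Continuous fun p : ℝ × H =>
      (fderiv ℝ f p).comp (ContinuousLinearMap.inr ℝ ℝ H) :=
    hfd.clm_comp continuous_const
  have hcpt : IsCompact (uIcc a b ×ˢ Metric.closedBall z 1) :=
    isCompact_uIcc.prod (isCompact_closedBall z 1)
  obtain ⟨C, hC⟩ := hcpt.exists_bound_of_continuousOn hF'.continuousOn
  refine intervalIntegral.hasFDerivAt_integral_of_dominated_of_fderiv_le (bound := fun _ => C)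
    (F' := fun z s => (fderiv ℝ f (s, z)).comp (ContinuousLinearMap.inr ℝ ℝ H))
    (Metric.closedBall_mem_nhds z one_pos) ?_ ?_ ?_ ?_ ?_ ?_
  · exact Eventually.of_forall fun x =>
      (hf.continuous.comp (Continuous.prodMk_left x)).aestronglyMeasurable
  · exact (hf.continuous.comp (Continuous.prodMk_left z)).intervalIntegrable _ _
  · exact (hF'.comp (Continuous.prodMk_left z)).aestronglyMeasurable
  · exact Eventually.of_forall fun t ht x hx => hC (t, x) ⟨uIoc_subset_uIcc ht, hx⟩
  · exact intervalIntegrable_const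
  · refine Eventually.of_forall fun t _ x _ => ?_
    exact ((hf.differentiable one_ne_zero (t, x)).hasFDerivAt).comp x (hasFDerivAt_prodMk_right t x)

theorem contDiff_one_intervalIntegral_param {H F : Type*} [NormedAddCommGroup H] [NormedSpace ℝ H]
    [ProperSpace H] [NormedAddCommGroup F] [NormedSpace ℝ F] [CompleteSpace F]
    {f : ℝ × H → F} (hf : ContDiff ℝ 1 f) (a b : ℝ) :
    ContDiff ℝ 1 (fun z => ∫ s in a..b, f (s, z)) := by
  rw [contDiff_one_iff_fderiv]
  refine ⟨fun z => (hasFDerivAt_intervalIntegral_param hf a b z).differentiableAt, ?_⟩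
  rw [show fderiv ℝ (fun z => ∫ s in a..b, f (s, z)) = fun z => ∫ s in a..b,
    (fderiv ℝ f (s, z)).comp (ContinuousLinearMap.inr ℝ ℝ H) from
    funext fun z => (hasFDerivAt_intervalIntegral_param hf a b z).fderiv]
  apply intervalIntegral.continuous_parametric_intervalIntegral_of_continuous'
  have hfd : Continuous (fderiv ℝ f) := hf.continuous_fderiv one_ne_zero
  exact (hfd.comp continuous_swap).clm_comp continuous_const

variable {n : ℕ} {L : E n × E n → ℝ}

theorem partialV_eq (hL : Differentiable ℝ L) (x v : E n) :
    partialV n L x v = (fderiv ℝ L (x, v)).comp (ContinuousLinearMap.inr ℝ (E n) (E n)) :=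
  (((hL (x, v)).hasFDerivAt).comp v (hasFDerivAt_prodMk_right x v)).fderiv

theorem partialX_eq (hL : Differentiable ℝ L) (x v : E n) :
    partialX n L x v = (fderiv ℝ L (x, v)).comp (ContinuousLinearMap.inl ℝ (E n) (E n)) :=
  (HasFDerivAt.comp (g := L) x (hL (x, v)).hasFDerivAt (hasFDerivAt_prodMk_left x v)).fderiv

theorem fderiv_eq_partialX_add_partialV (hL : Differentiable ℝ L) (z w : E n × E n) :
    fderiv ℝ L z w = partialX n L z.1 z.2 w.1 + partialV n L z.1 z.2 w.2 := by
  rw [partialX_eq hL, partialV_eq hL]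
  simp [← map_add]

theorem contDiff_partialV (hL : ContDiff ℝ 2 L) :
    ContDiff ℝ 1 (fun z : E n × E n => partialV n L z.1 z.2) := by
  simp_rw [partialV_eq (hL.differentiable two_ne_zero)]
  exact (hL.fderiv_right (m := 1) (by norm_num)).clm_comp contDiff_const

theorem contDiff_partialX (hL : ContDiff ℝ 2 L) :
    ContDiff ℝ 1 (fun z : E n × E n => partialX n L z.1 z.2) := by
  simp_rw [partialX_eq (hL.differentiable two_ne_zero)]
  exact (hL.fderiv_right (m := 1) (by norm_num)).clm_comp contDiff_const

namespace IsTonelliLagrangian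

variable {k : ℕ}

theorem contDiff_two (hL : IsTonelliLagrangian n (k : ℕ∞) L) (hk : 2 ≤ k) : ContDiff ℝ 2 L :=
  hL.smooth.of_le (WithTop.coe_le_coe.2 (Nat.cast_le.2 hk))

theorem hasDerivAt_partialV_line (hL : IsTonelliLagrangian n (k : ℕ∞) L) (hk : 2 ≤ k)
    (x v w : E n) (s : ℝ) :
    HasDerivAt (fun s : ℝ => partialV n L x (v + s • w) w)
      (fderiv ℝ (fun v' => partialV n L x v' w) (v + s • w) w) s := by
  have h1 : Differentiable ℝ (fun v' => partialV n L x v' w) := fun v' =>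
    (((contDiff_partialV (hL.contDiff_two hk)).comp
      (contDiff_prodMk_right x)).differentiable one_ne_zero v').clm_apply
      (differentiableAt_const w)
  have h2 : HasDerivAt (fun s : ℝ => v + s • w) w s := by
    simpa using ((hasDerivAt_id s).smul_const w).const_add v
  exact (h1 _).hasFDerivAt.comp_hasDerivAt s h2

theorem strictMono_partialV_line (hL : IsTonelliLagrangian n (k : ℕ∞) L) (hk : 2 ≤ k)
    (x v w : E n) (hw : w ≠ 0) : StrictMono (fun s : ℝ => partialV n L x (v + s • w) w) :=
  strictMono_of_deriv_pos fun s => by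
    rw [(hL.hasDerivAt_partialV_line hk x v w s).deriv]
    exact hL.posdef x (v + s • w) w hw

theorem partialV_injective (hL : IsTonelliLagrangian n (k : ℕ∞) L) (hk : 2 ≤ k)
    (x : E n) : Function.Injective (partialV n L x) := by
  intro v w h
  by_contra hne
  have := hL.strictMono_partialV_line hk x v (w - v) (sub_ne_zero.2 (Ne.symm hne)) one_pos
  simp [h] at this

theorem add_partialV_le (hL : IsTonelliLagrangian n (k : ℕ∞) L) (hk : 2 ≤ k)
    (x v w : E n) : L (x, v) + partialV n L x v (w - v) ≤ L (x, w) := by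
  rcases eq_or_ne w v with rfl | hne
  · simp
  have hd : ∀ s : ℝ, HasDerivAt (fun s : ℝ => L (x, v + s • (w - v)))
      (partialV n L x (v + s • (w - v)) (w - v)) s := by
    intro s
    have h2 : HasDerivAt (fun s : ℝ => v + s • (w - v)) (w - v) s := by
      simpa using ((hasDerivAt_id s).smul_const (w - v)).const_add v
    have h1 : Differentiable ℝ (fun v' => L (x, v')) :=
      ((hL.contDiff_two hk).comp (contDiff_prodMk_right x)).differentiable two_ne_zero
    exact (h1 _).hasFDerivAt.comp_hasDerivAt s h2
  obtain ⟨s, hs, h⟩ := exists_hasDerivAt_eq_slope _ _ (zero_lt_one' ℝ)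
    (fun s _ => (hd s).continuousAt.continuousWithinAt) (fun s _ => hd s)
  have := hL.strictMono_partialV_line hk x v (w - v) (sub_ne_zero.2 hne) hs.1
  simp only [add_sub_cancel, one_smul, zero_smul, add_zero, sub_zero, div_one] at h this
  linarith

theorem partialV_add_intVec (hL : IsTonelliLagrangian n (k : ℕ∞) L)
    (x v : E n) (m : Fin n → ℤ) : partialV n L (x + intVec m) v = partialV n L x v := by
  simp only [partialV, hL.periodic]

end IsTonelliLagrangian

end

theorem exists_openPartialHomeomorph_of_injective_fderiv {V : Type*} [NormedAddCommGroup V]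
    [NormedSpace ℝ V] [FiniteDimensional ℝ V] {f : V → V} (hf : ContDiff ℝ 1 f) (a : V)
    (hinj : ∀ w, fderiv ℝ f a w = 0 → w = 0) :
    ∃ e : OpenPartialHomeomorph V V, ⇑e = f ∧ a ∈ e.source ∧ ContDiffAt ℝ 1 e.symm (f a) := by
  have := FiniteDimensional.complete ℝ V
  let e₀ : V ≃ₗ[ℝ] V := LinearEquiv.ofInjectiveEndo (fderiv ℝ f a : V →ₗ[ℝ] V)
    ((injective_iff_map_eq_zero _).2 hinj)
  have he₀ : HasFDerivAt f (e₀.toContinuousLinearEquiv : V →L[ℝ] V) a := by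
    convert! (hf.differentiable one_ne_zero a).hasFDerivAt using 1
  exact ⟨hf.contDiffAt.toOpenPartialHomeomorph f he₀ one_ne_zero, rfl,
    hf.contDiffAt.mem_toOpenPartialHomeomorph_source he₀ one_ne_zero,
    hf.contDiffAt.to_localInverse he₀ one_ne_zero⟩

variable {n k : ℕ} {L : E n × E n → ℝ}

/-- The coordinates of a linear form on `ℝⁿ`. -/
def formCoords (n : ℕ) : (E n →L[ℝ] ℝ) →L[ℝ] E n :=
  ContinuousLinearMap.pi fun i => ContinuousLinearMap.apply ℝ ℝ (Pi.single i (1 : ℝ) : E n)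

theorem formCoords_injective : Function.Injective (formCoords n) := by
  intro f g h
  exact ContinuousLinearMap.coe_injective (LinearMap.pi_ext' fun i =>
    LinearMap.ext_ring (by simpa [formCoords] using congrFun h i))

/-- The Legendre transform `(x, v) ↦ (x, ∂L/∂v(x, v))`. -/
def legendre (n : ℕ) (L : E n × E n → ℝ) (z : E n × E n) : E n × E n :=
  (z.1, formCoords n (partialV n L z.1 z.2))

namespace IsTonelliLagrangian

theorem contDiff_legendre (hL : IsTonelliLagrangian n (k : ℕ∞) L) (hk : 2 ≤ k) :
    ContDiff ℝ 1 (legendre n L) :=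
  contDiff_fst.prodMk ((formCoords n).contDiff.comp (contDiff_partialV (hL.contDiff_two hk)))

theorem legendre_injective (hL : IsTonelliLagrangian n (k : ℕ∞) L) (hk : 2 ≤ k) :
    Function.Injective (legendre n L) := by
  rintro ⟨x, v⟩ ⟨y, w⟩ h
  obtain ⟨rfl, h⟩ := Prod.mk.inj h
  exact congrArg _ (hL.partialV_injective hk x (formCoords_injective h))

theorem fderiv_legendre_injective (hL : IsTonelliLagrangian n (k : ℕ∞) L) (hk : 2 ≤ k)
    (z w : E n × E n) (h : fderiv ℝ (legendre n L) z w = 0) : w = 0 := by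
  obtain ⟨x, v⟩ := z
  have hp := ((contDiff_partialV (hL.contDiff_two hk)).differentiable one_ne_zero (x, v)).hasFDerivAt
  have hd : HasFDerivAt (legendre n L) ((ContinuousLinearMap.fst ℝ (E n) (E n)).prod
      ((formCoords n).comp (fderiv ℝ (fun z : E n × E n => partialV n L z.1 z.2) (x, v)))) (x, v) :=
    hasFDerivAt_fst.prodMk ((formCoords n).hasFDerivAt.comp _ hp)
  rw [hd.fderiv] at h
  obtain ⟨h1, h2⟩ := Prod.mk.inj h
  obtain ⟨w1, w2⟩ := w
  change w1 = 0 at h1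
  subst h1
  have h3 : fderiv ℝ (fun z : E n × E n => partialV n L z.1 z.2) (x, v) (0, w2) = 0 :=
    formCoords_injective (h2.trans (map_zero _).symm)
  by_contra hne
  have hw : w2 ≠ 0 := fun h => hne (by rw [h]; rfl)
  have hpos := hL.posdef x v w2 hw
  have hq : HasFDerivAt (fun v' => partialV n L x v' w2)
      (((fderiv ℝ (fun z : E n × E n => partialV n L z.1 z.2) (x, v)).comp
        (ContinuousLinearMap.inr ℝ (E n) (E n))).flip w2) v :=
    (hp.comp v (hasFDerivAt_prodMk_right x v)).clm_apply (hasFDerivAt_const w2 v) |>.congr_fderiv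
      (by ext; simp)
  change 0 < fderiv ℝ (fun v' => partialV n L x v' w2) v w2 at hpos
  rw [hq.fderiv] at hpos
  simp [h3] at hpos

end IsTonelliLagrangian

theorem IsExtremal.hasDerivAt {γ : ℝ → E n} (h : IsExtremal n L γ) (t : ℝ) :
    HasDerivAt γ (deriv γ t) t :=
  (h.1.differentiable two_ne_zero t).hasDerivAt

theorem IsExtremal.continuous_deriv {γ : ℝ → E n} (h : IsExtremal n L γ) :
    Continuous (deriv γ) :=
  h.1.continuous_deriv one_le_two

theorem IsExtremal.eventuallyEq (hL : IsTonelliLagrangian n (k : ℕ∞) L) (hk : 2 ≤ k)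
    {γ₀ γ₁ : ℝ → E n} (h₀ : IsExtremal n L γ₀) (h₁ : IsExtremal n L γ₁) (t₀ : ℝ)
    (h : (γ₀ t₀, deriv γ₀ t₀) = (γ₁ t₀, deriv γ₁ t₀)) :
    (fun t => (γ₀ t, deriv γ₀ t)) =ᶠ[𝓝 t₀] fun t => (γ₁ t, deriv γ₁ t) := by
  obtain ⟨e, he, hae, hes⟩ := exists_openPartialHomeomorph_of_injective_fderiv
    (hL.contDiff_legendre hk) (γ₀ t₀, deriv γ₀ t₀) (hL.fderiv_legendre_injective hk _)
  let F : E n × E n → E n × E n := fun z => (z.2, formCoords n (partialX n L z.1 z.2))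
  have hF : ContDiff ℝ 1 F :=
    contDiff_snd.prodMk ((formCoords n).contDiff.comp (contDiff_partialX (hL.contDiff_two hk)))
  have hX : ContDiffAt ℝ 1 (F ∘ e.symm) (legendre n L (γ₀ t₀, deriv γ₀ t₀)) :=
    hF.contDiffAt.comp _ hes
  obtain ⟨K, s, hs, hK⟩ := hX.exists_lipschitzOnWith
  have key : ∀ γ : ℝ → E n, IsExtremal n L γ → (γ t₀, deriv γ t₀) = (γ₀ t₀, deriv γ₀ t₀) →
      ∀ᶠ t in 𝓝 t₀, HasDerivAt (fun t => legendre n L (γ t, deriv γ t))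
        ((F ∘ e.symm) (legendre n L (γ t, deriv γ t))) t ∧
          legendre n L (γ t, deriv γ t) ∈ s := by
    intro γ hγ hγ0
    have hc : Continuous fun t => (γ t, deriv γ t) := hγ.1.continuous.prodMk hγ.continuous_deriv
    have h1 : ∀ᶠ t in 𝓝 t₀, (γ t, deriv γ t) ∈ e.source :=
      hc.continuousAt.eventually_mem (by rw [hγ0]; exact e.open_source.mem_nhds hae)
    have h2 : ∀ᶠ t in 𝓝 t₀, legendre n L (γ t, deriv γ t) ∈ s :=
      ((hL.contDiff_legendre hk).continuous.comp hc).continuousAt.eventually_mem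
        (by simpa [Function.comp, hγ0] using hs)
    filter_upwards [h1, h2] with t ht1 ht2
    refine ⟨?_, ht2⟩
    have h3 : e.symm (legendre n L (γ t, deriv γ t)) = (γ t, deriv γ t) := by
      rw [← he]; exact e.left_inv ht1
    rw [Function.comp_apply, h3]
    exact (hγ.hasDerivAt t).prodMk ((formCoords n).hasFDerivAt.comp_hasDerivAt t (hγ.2 t))
  have := ODE_solution_unique_of_eventually (v := fun _ => F ∘ e.symm) (s := fun _ => s) (K := K)
    (Eventually.of_forall fun _ => hK) (key γ₀ h₀ rfl) (key γ₁ h₁ h.symm) (by simp only [h])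
  filter_upwards [this] with t ht
  exact hL.legendre_injective hk ht

theorem IsExtremal.eq_of_eq (hL : IsTonelliLagrangian n (k : ℕ∞) L) (hk : 2 ≤ k)
    {γ₀ γ₁ : ℝ → E n} (h₀ : IsExtremal n L γ₀) (h₁ : IsExtremal n L γ₁) (t₀ : ℝ)
    (h : γ₀ t₀ = γ₁ t₀) (h' : deriv γ₀ t₀ = deriv γ₁ t₀) : γ₀ = γ₁ := by
  let S : Set ℝ := {t | (γ₀ t, deriv γ₀ t) = (γ₁ t, deriv γ₁ t)}
  have hcl : IsClosed S := isClosed_eq (h₀.1.continuous.prodMk h₀.continuous_deriv)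
    (h₁.1.continuous.prodMk h₁.continuous_deriv)
  have hop : IsOpen S := isOpen_iff_mem_nhds.2 fun t ht => h₀.eventuallyEq hL hk h₁ t ht
  have : S = univ := IsClopen.eq_univ ⟨hcl, hop⟩ ⟨t₀, by simp only [S, mem_ofPred_eq, h, h']⟩
  funext t
  have ht : t ∈ S := this ▸ mem_univ t
  exact (Prod.mk.inj ht).1

theorem IsExtremal.comp_add {γ : ℝ → E n} (h : IsExtremal n L γ) (s : ℝ) :
    IsExtremal n L (fun t => γ (t + s)) := by
  refine ⟨h.1.comp (contDiff_id.add contDiff_const), fun t => ?_⟩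
  simp_rw [deriv_comp_add_const γ s]
  exact (h.2 (t + s)).comp_add_const t s

theorem IsExtremal.add_intVec (hL : IsTonelliLagrangian n (k : ℕ∞) L) {γ : ℝ → E n}
    (h : IsExtremal n L γ) (m : Fin n → ℤ) : IsExtremal n L (fun t => γ t + intVec m) := by
  have hX : ∀ x v, partialX n L (x + intVec m) v = partialX n L x v := fun x v => by
    rw [partialX, partialX, ← fderiv_comp_add_right]
    simp only [hL.periodic]
  refine ⟨h.1.add contDiff_const, fun t => ?_⟩
  simp_rw [deriv_add_const, hL.partialV_add_intVec, hX]
  exact h.2 t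

namespace IsELFlow

variable {φ : ℝ → E n × E n → E n × E n}

theorem contDiff (hφ : IsELFlow n k L φ) (hk : 2 ≤ k) :
    ContDiff ℝ 1 (fun p : ℝ × (E n × E n) => φ p.1 p.2) :=
  hφ.1.of_le (WithTop.coe_le_coe.2 (Nat.one_le_cast.2 (by omega)))

theorem contDiff_apply (hφ : IsELFlow n k L φ) (hk : 2 ≤ k) (t : ℝ) : ContDiff ℝ 1 (φ t) :=
  (hφ.contDiff hk).comp (contDiff_prodMk_right t)

theorem hasDerivAt_fst (hφ : IsELFlow n k L φ) (z : E n × E n) (t : ℝ) :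
    HasDerivAt (fun s => (φ s z).1) (φ t z).2 t := by
  rw [show (φ t z).2 = _ from (hφ.2.2 z.1 z.2).2 t]
  exact (hφ.2.2 z.1 z.2).1.hasDerivAt t

theorem apply_of_isExtremal (hφ : IsELFlow n k L φ) (hL : IsTonelliLagrangian n (k : ℕ∞) L)
    (hk : 2 ≤ k) {c : ℝ → E n} (hc : IsExtremal n L c) (s t : ℝ) :
    φ t (c s, deriv c s) = (c (t + s), deriv c (t + s)) := by
  obtain ⟨h1, h2⟩ := hφ.2.2 (c s) (deriv c s)
  have h0 := hφ.2.1 (c s, deriv c s)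
  have : (fun t => (φ t (c s, deriv c s)).1) = fun t => c (t + s) := by
    refine h1.eq_of_eq hL hk (hc.comp_add s) 0 (by simp [h0]) ?_
    rw [← h2 0, h0, deriv_comp_add_const, zero_add]
  refine Prod.ext (congrFun this t) ?_
  rw [h2 t, this, deriv_comp_add_const]

theorem apply_apply (hφ : IsELFlow n k L φ) (hL : IsTonelliLagrangian n (k : ℕ∞) L)
    (hk : 2 ≤ k) (s t : ℝ) (z : E n × E n) : φ t (φ s z) = φ (t + s) z := by
  obtain ⟨h1, h2⟩ := hφ.2.2 z.1 z.2
  have := hφ.apply_of_isExtremal hL hk h1 s t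
  rw [← h2, ← h2] at this
  exact this

theorem apply_add_intVec (hφ : IsELFlow n k L φ) (hL : IsTonelliLagrangian n (k : ℕ∞) L)
    (hk : 2 ≤ k) (t : ℝ) (x v : E n) (m : Fin n → ℤ) :
    φ t (x + intVec m, v) = ((φ t (x, v)).1 + intVec m, (φ t (x, v)).2) := by
  obtain ⟨h1, h2⟩ := hφ.2.2 x v
  have := hφ.apply_of_isExtremal hL hk (h1.add_intVec hL m) 0 t
  simp_rw [deriv_add_const, add_zero, ← h2, hφ.2.1] at this
  exact this

end IsELFlow

theorem HasDerivAt.comp_prodMk_curve {H F : Type*} [NormedAddCommGroup H] [NormedSpace ℝ H]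
    [NormedAddCommGroup F] [NormedSpace ℝ F] {f : ℝ → H → F} {ζ : ℝ → H} {ζ' : H} {t : ℝ} {a : F}
    (ha : HasDerivAt (fun s => f s (ζ t)) a t)
    (hf : DifferentiableAt ℝ (fun p : ℝ × H => f p.1 p.2) (t, ζ t)) (hζ : HasDerivAt ζ ζ' t) :
    HasDerivAt (fun s => f s (ζ s)) (a + fderiv ℝ (f t) (ζ t) ζ') t := by
  have h := hf.hasFDerivAt
  have h1 := (h.comp (ζ t) (hasFDerivAt_prodMk_right t (ζ t))).fderiv
  have h2 : HasDerivAt (fun s => f s (ζ t)) _ t :=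
    h.comp_hasDerivAt (f := fun s => (s, ζ t)) t ((hasDerivAt_id t).prodMk (hasDerivAt_const t _))
  have h3 : HasDerivAt (fun s => f s (ζ s)) _ t :=
    h.comp_hasDerivAt (f := fun s => (s, ζ s)) t ((hasDerivAt_id t).prodMk hζ)
  convert! h3 using 1
  change a + fderiv ℝ ((fun p : ℝ × H => f p.1 p.2) ∘ fun y => (t, y)) (ζ t) ζ' = _
  rw [h1, ha.unique h2]
  simp [← map_add]

/-- The mean over `[0, t]` of the velocity along the orbit of `z`. -/
def meanVel (φ : ℝ → E n × E n → E n × E n) (t : ℝ) (z : E n × E n) : E n :=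
  ∫ s in (0 : ℝ)..1, (φ (s * t) z).2

/-- The Lagrangian action over `[0, t]` of the orbit of `z`. -/
def action (L : E n × E n → ℝ) (φ : ℝ → E n × E n → E n × E n) (t : ℝ) (z : E n × E n) : ℝ :=
  ∫ s in (0 : ℝ)..t, L (φ s z)

namespace IsELFlow

theorem continuous_orbit (hφ : IsELFlow n k L φ) (hk : 2 ≤ k) (z : E n × E n) :
    Continuous fun s => φ s z :=
  (hφ.contDiff hk).continuous.comp (Continuous.prodMk_left z)

theorem contDiff_meanVel (hφ : IsELFlow n k L φ) (hk : 2 ≤ k) :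
    ContDiff ℝ 1 (fun p : ℝ × (E n × E n) => meanVel φ p.1 p.2) := by
  have : ContDiff ℝ 1 (fun q : ℝ × (ℝ × (E n × E n)) => (φ (q.1 * q.2.1) q.2.2).2) :=
    contDiff_snd.comp ((hφ.contDiff hk).comp ((contDiff_fst.mul contDiff_snd.fst).prodMk
      contDiff_snd.snd))
  exact contDiff_one_intervalIntegral_param this 0 1

theorem integral_snd (hφ : IsELFlow n k L φ) (hk : 2 ≤ k) (t : ℝ) (z : E n × E n) :
    ∫ s in (0 : ℝ)..t, (φ s z).2 = (φ t z).1 - z.1 := by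
  rw [intervalIntegral.integral_eq_sub_of_hasDerivAt (fun s _ => hφ.hasDerivAt_fst z s)
    ((hφ.continuous_orbit hk z).snd.intervalIntegrable _ _), hφ.2.1]

theorem fst_eq (hφ : IsELFlow n k L φ) (hk : 2 ≤ k) (t : ℝ) (z : E n × E n) :
    (φ t z).1 = z.1 + t • meanVel φ t z := by
  rw [meanVel, intervalIntegral.smul_integral_comp_mul_right (fun s => (φ s z).2), zero_mul,
    one_mul, hφ.integral_snd hk]
  abel

theorem meanVel_zero (hφ : IsELFlow n k L φ) (z : E n × E n) : meanVel φ 0 z = z.2 := by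
  simp [meanVel, hφ.2.1]

theorem contDiff_action (hφ : IsELFlow n k L φ) (hL : IsTonelliLagrangian n (k : ℕ∞) L)
    (hk : 2 ≤ k) : ContDiff ℝ 1 (fun p : ℝ × (E n × E n) => action L φ p.1 p.2) := by
  have h1 : ContDiff ℝ 1 (fun q : ℝ × (ℝ × (E n × E n)) => L (φ (q.1 * q.2.1) q.2.2)) :=
    ((hL.contDiff_two hk).of_le one_le_two).comp
      ((hφ.contDiff hk).comp ((contDiff_fst.mul contDiff_snd.fst).prodMk contDiff_snd.snd))
  convert contDiff_fst.smul (contDiff_one_intervalIntegral_param h1 0 1) using 2 with p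
  change _ = p.1 • ∫ s in (0 : ℝ)..1, L (φ (s * p.1) p.2)
  rw [intervalIntegral.smul_integral_comp_mul_right (fun s => L (φ s p.2)), zero_mul, one_mul]
  rfl

theorem continuous_lagrangian_orbit (hφ : IsELFlow n k L φ)
    (hL : IsTonelliLagrangian n (k : ℕ∞) L) (hk : 2 ≤ k) (z : E n × E n) :
    Continuous fun s => L (φ s z) :=
  (hL.contDiff_two hk).continuous.comp (hφ.continuous_orbit hk z)

theorem fderiv_apply (hφ : IsELFlow n k L φ) (hk : 2 ≤ k) (t : ℝ) (z : E n × E n) :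
    fderiv ℝ (φ t) z = (fderiv ℝ (fun p : ℝ × (E n × E n) => φ p.1 p.2) (t, z)).comp
      (ContinuousLinearMap.inr ℝ ℝ (E n × E n)) :=
  ((((hφ.contDiff hk).differentiable one_ne_zero (t, z)).hasFDerivAt).comp z
    (hasFDerivAt_prodMk_right t z)).fderiv

theorem continuous_fderiv_apply (hφ : IsELFlow n k L φ) (hk : 2 ≤ k) (z w : E n × E n) :
    Continuous fun t => fderiv ℝ (φ t) z w := by
  simp_rw [hφ.fderiv_apply hk]
  exact (((hφ.contDiff hk).continuous_fderiv one_ne_zero).comp (Continuous.prodMk_left z)).clm_apply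
    continuous_const

theorem hasFDerivAt_apply (hφ : IsELFlow n k L φ) (hk : 2 ≤ k) (t : ℝ) (z : E n × E n) :
    HasFDerivAt (φ t) (fderiv ℝ (φ t) z) z :=
  ((hφ.contDiff_apply hk t).differentiable one_ne_zero z).hasFDerivAt

theorem fderiv_param {F : Type*} [NormedAddCommGroup F] [NormedSpace ℝ F]
    (hφ : IsELFlow n k L φ) (hk : 2 ≤ k) {f : E n × E n → F} (hf : ContDiff ℝ 1 f) (s : ℝ)
    (z w : E n × E n) :
    (fderiv ℝ (fun p : ℝ × (E n × E n) => f (φ p.1 p.2)) (s, z)).comp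
      (ContinuousLinearMap.inr ℝ ℝ (E n × E n)) w = fderiv ℝ f (φ s z) (fderiv ℝ (φ s) z w) := by
  rw [hφ.fderiv_apply hk]
  have h1 := ((hφ.contDiff hk).differentiable one_ne_zero (s, z)).hasFDerivAt
  have h2 := (hf.differentiable one_ne_zero (φ s z)).hasFDerivAt
  have h3 : HasFDerivAt (fun p : ℝ × (E n × E n) => f (φ p.1 p.2)) _ (s, z) :=
    HasFDerivAt.comp (s, z) h2 h1
  rw [h3.fderiv]
  rfl

theorem hasFDerivAt_integral {F : Type*} [NormedAddCommGroup F] [NormedSpace ℝ F]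
    [CompleteSpace F] (hφ : IsELFlow n k L φ) (hk : 2 ≤ k) {f : E n × E n → F}
    (hf : ContDiff ℝ 1 f) (t : ℝ) (z : E n × E n) :
    ∃ D : E n × E n →L[ℝ] F, HasFDerivAt (fun z => ∫ s in (0 : ℝ)..t, f (φ s z)) D z ∧
      ∀ w, D w = ∫ s in (0 : ℝ)..t, fderiv ℝ f (φ s z) (fderiv ℝ (φ s) z w) := by
  have hc : ContDiff ℝ 1 (fun p : ℝ × (E n × E n) => f (φ p.1 p.2)) := hf.comp (hφ.contDiff hk)
  refine ⟨_, hasFDerivAt_intervalIntegral_param hc 0 t z, fun w => ?_⟩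
  rw [ContinuousLinearMap.intervalIntegral_apply]
  · simp_rw [hφ.fderiv_param hk hf]
  · exact (((hc.continuous_fderiv one_ne_zero).comp (Continuous.prodMk_left z)).clm_comp
      continuous_const).intervalIntegrable _ _

theorem hasDerivAt_fderiv_fst (hφ : IsELFlow n k L φ) (hk : 2 ≤ k) (z w : E n × E n) (t : ℝ) :
    HasDerivAt (fun s => (fderiv ℝ (φ s) z w).1) (fderiv ℝ (φ t) z w).2 t := by
  have key : ∀ s, (fderiv ℝ (φ s) z w).1 = w.1 + ∫ r in (0 : ℝ)..s, (fderiv ℝ (φ r) z w).2 := by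
    intro s
    obtain ⟨D, hD, hDw⟩ := hφ.hasFDerivAt_integral hk (contDiff_snd (𝕜 := ℝ) (n := 1)
      (E := E n) (F := E n)) s z
    have h1 : HasFDerivAt (fun z => (φ s z).1) (ContinuousLinearMap.fst ℝ (E n) (E n) + D) z := by
      have := (hasFDerivAt_fst (𝕜 := ℝ) (p := z)).add hD
      simp_rw [hφ.integral_snd hk] at this
      refine this.congr_of_eventuallyEq (Eventually.of_forall fun z => ?_)
      simp
    have h2 : HasFDerivAt (fun z => (φ s z).1) _ z := (hφ.hasFDerivAt_apply hk s z).fst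
    have h3 := congrArg (fun A => A w) (h2.unique h1)
    simpa [hDw, fderiv_snd] using h3
  simp_rw [key]
  exact ((hφ.continuous_fderiv_apply hk z w).snd.integral_hasStrictDerivAt 0 t).hasDerivAt.const_add _

theorem fderiv_zero (hφ : IsELFlow n k L φ) (z w : E n × E n) : fderiv ℝ (φ 0) z w = w := by
  rw [show φ 0 = id from funext hφ.2.1, fderiv_id]
  rfl

theorem hasDerivAt_momentum (hφ : IsELFlow n k L φ) (z : E n × E n) (t : ℝ) :
    HasDerivAt (fun s => partialV n L (φ s z).1 (φ s z).2)
      (partialX n L (φ t z).1 (φ t z).2) t := by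
  obtain ⟨h1, h2⟩ := hφ.2.2 z.1 z.2
  have := h1.2 t
  simp_rw [← h2] at this
  exact this

/-- First variation formula. -/
theorem fderiv_action (hφ : IsELFlow n k L φ) (hL : IsTonelliLagrangian n (k : ℕ∞) L)
    (hk : 2 ≤ k) (t : ℝ) (z w : E n × E n) :
    fderiv ℝ (action L φ t) z w =
      partialV n L (φ t z).1 (φ t z).2 (fderiv ℝ (φ t) z w).1 - partialV n L z.1 z.2 w.1 := by
  have hL2 := hL.contDiff_two hk
  have hL1 := hL2.of_le one_le_two
  obtain ⟨D, hD, hDw⟩ := hφ.hasFDerivAt_integral hk hL1 t z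
  have hD' : HasFDerivAt (action L φ t) D z := hD
  have hd : ∀ s, HasDerivAt
      (fun s => partialV n L (φ s z).1 (φ s z).2 (fderiv ℝ (φ s) z w).1)
      (fderiv ℝ L (φ s z) (fderiv ℝ (φ s) z w)) s := fun s => by
    rw [fderiv_eq_partialX_add_partialV (hL1.differentiable one_ne_zero)]
    exact (hφ.hasDerivAt_momentum z s).clm_apply (hφ.hasDerivAt_fderiv_fst hk z w s)
  rw [hD'.fderiv, hDw, intervalIntegral.integral_eq_sub_of_hasDerivAt (fun s _ => hd s),
    hφ.fderiv_zero, hφ.2.1]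
  exact (((hL1.continuous_fderiv one_ne_zero).comp (hφ.continuous_orbit hk z)).clm_apply
    (hφ.continuous_fderiv_apply hk z w)).intervalIntegrable _ _

/-- Weierstrass inequality: varying the initial velocity, the action of the orbits ending on a
curve grows at most as fast as the action of that curve. -/
theorem exists_hasDerivAt_action_le (hφ : IsELFlow n k L φ)
    (hL : IsTonelliLagrangian n (k : ℕ∞) L) (hk : 2 ≤ k) {ζ : ℝ → E n × E n} {ζ' : E n × E n}
    {t : ℝ} (hζ : HasDerivAt ζ ζ' t) (h0 : ζ'.1 = 0) {y' : E n}
    (hy : HasDerivAt (fun s => (φ s (ζ s)).1) y' t) :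
    ∃ a', HasDerivAt (fun s => action L φ s (ζ s)) a' t ∧ a' ≤ L ((φ t (ζ t)).1, y') := by
  have h1 : HasDerivAt (fun s => action L φ s (ζ t)) (L (φ t (ζ t))) t :=
    ((hφ.continuous_lagrangian_orbit hL hk (ζ t)).integral_hasStrictDerivAt 0 t).hasDerivAt
  refine ⟨_, h1.comp_prodMk_curve ((hφ.contDiff_action hL hk).differentiable one_ne_zero _) hζ, ?_⟩
  have h2 := (hφ.hasDerivAt_fst (ζ t) t).comp_prodMk_curve (f := fun s z => (φ s z).1) (ζ := ζ)
    (contDiff_fst.comp (hφ.contDiff hk) |>.differentiable one_ne_zero _) hζ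
  have h3 := hy.unique h2
  rw [((hφ.hasFDerivAt_apply hk t (ζ t)).fst).fderiv] at h3
  rw [hφ.fderiv_action hL hk, h0, map_zero, sub_zero]
  have h4 := hL.add_partialV_le hk (φ t (ζ t)).1 (φ t (ζ t)).2 y'
  rw [h3] at h4 ⊢
  simpa using h4

/-- A priori bound on the velocity of orbits of bounded mean action. -/
theorem exists_norm_le_of_action_le (hφ : IsELFlow n k L φ)
    (hL : IsTonelliLagrangian n (k : ℕ∞) L) (hk : 2 ≤ k) (T C : ℝ) :
    ∃ R, ∀ t z, 0 < t → t ≤ T → action L φ t z ≤ C * t → ‖z.2‖ ≤ R := by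
  obtain ⟨R₁, hR₁⟩ := hL.superlinear 1
  have hcont : Continuous fun p : ℝ × (E n × E n) => (φ (-p.1) p.2).2 :=
    ((hφ.contDiff hk).continuous.comp (continuous_fst.neg.prodMk continuous_snd)).snd
  have hcpt : IsCompact (Icc 0 T ×ˢ (Metric.closedBall (0 : E n) 1 ×ˢ
      Metric.closedBall (0 : E n) (max R₁ C))) :=
    isCompact_Icc.prod ((isCompact_closedBall _ _).prod (isCompact_closedBall _ _))
  obtain ⟨R, hR⟩ := hcpt.exists_bound_of_continuousOn hcont.continuousOn
  refine ⟨R, fun t z ht htT hA => ?_⟩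
  obtain ⟨s, hs, hsC⟩ : ∃ s ∈ Icc 0 t, L (φ s z) ≤ C := by
    by_contra! hcon
    have h1 := intervalIntegral.integral_lt_integral_of_continuousOn_of_le_of_exists_lt ht
      continuousOn_const (hφ.continuous_lagrangian_orbit hL hk z).continuousOn
      (fun s hs => (hcon s (Ioc_subset_Icc_self hs)).le)
      ⟨0, left_mem_Icc.2 ht.le, hcon 0 (left_mem_Icc.2 ht.le)⟩
    rw [intervalIntegral.integral_const, sub_zero, smul_eq_mul] at h1
    rw [action] at hA
    linarith
  have hv : ‖(φ s z).2‖ ≤ max R₁ C := by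
    rcases le_total R₁ ‖(φ s z).2‖ with h | h
    · have := hR₁ (φ s z).1 (φ s z).2 h
      exact le_max_of_le_right (by linarith)
    · exact le_max_of_le_left h
  let m : Fin n → ℤ := fun i => -⌊(φ s z).1 i⌋
  have hq : (φ s z).1 + intVec m ∈ Metric.closedBall (0 : E n) 1 := by
    rw [mem_closedBall_zero_iff, pi_norm_le_iff_of_nonneg zero_le_one]
    intro i
    have h1 := Int.floor_le ((φ s z).1 i)
    have h2 := Int.lt_floor_add_one ((φ s z).1 i)
    simp only [Pi.add_apply, intVec, m, Real.norm_eq_abs, abs_le]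
    push_cast
    constructor <;> linarith
  have := hR (s, ((φ s z).1 + intVec m, (φ s z).2))
    ⟨⟨hs.1, hs.2.trans htT⟩, hq, mem_closedBall_zero_iff.2 hv⟩
  simpa [hφ.apply_add_intVec hL hk, hφ.apply_apply hL hk, hφ.2.1] using this

end IsELFlow

/-- The space-time exponential map, with displacements replaced by mean velocities, so that it
extends to `t = 0` by the identity. -/
def meanExp (φ : ℝ → E n × E n → E n × E n) (p : ℝ × (E n × E n)) : ℝ × (E n × E n) :=
  (p.1, (p.2.1, meanVel φ p.1 p.2))

/-- `u` is a lift of the curve `g` on `[0, t]`: the orbit of `(x, u s)` has mean velocity `g s`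
over `[0, s]`. -/
structure IsMeanLift (φ : ℝ → E n × E n → E n × E n) (x : E n) (g u : ℝ → E n) (t : ℝ) :
    Prop where
  continuousOn : ContinuousOn u (Icc 0 t)
  zero : u 0 = g 0
  eq : ∀ s ∈ Icc 0 t, meanVel φ s (x, u s) = g s

namespace IsELFlow

theorem contDiff_meanExp (hφ : IsELFlow n k L φ) (hk : 2 ≤ k) : ContDiff ℝ 1 (meanExp φ) :=
  contDiff_fst.prodMk (contDiff_snd.fst.prodMk (hφ.contDiff_meanVel hk))

theorem fderiv_meanExp_injective (hφ : IsELFlow n k L φ) (hnc : NoConjugatePoints n φ)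
    (hk : 2 ≤ k) (p w : ℝ × (E n × E n)) (h : fderiv ℝ (meanExp φ) p w = 0) : w = 0 := by
  obtain ⟨t, x, v⟩ := p
  obtain ⟨τ, ξ, w⟩ := w
  have hm := ((hφ.contDiff_meanVel hk).differentiable one_ne_zero (t, x, v)).hasFDerivAt
  have hd : HasFDerivAt (meanExp φ) _ (t, x, v) :=
    hasFDerivAt_fst.prodMk (hasFDerivAt_snd.fst.prodMk hm)
  rw [hd.fderiv] at h
  obtain ⟨h1, h2⟩ := Prod.mk.inj h
  obtain ⟨h2', h3⟩ := Prod.mk.inj h2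
  obtain rfl : τ = 0 := h1
  obtain rfl : ξ = 0 := h2'
  have h4 : HasFDerivAt (meanVel φ t) _ (x, v) :=
    hm.comp (x, v) (hasFDerivAt_prodMk_right t (x, v))
  have h5 : fderiv ℝ (meanVel φ t) (x, v) (0, w) = 0 := by rw [h4.fderiv]; exact h3
  suffices w = 0 by rw [this]; rfl
  rcases eq_or_ne t 0 with rfl | ht
  · rw [show meanVel φ 0 = Prod.snd from funext hφ.meanVel_zero, fderiv_snd] at h5
    exact h5
  · refine hnc (x, v) t ht w ?_
    have h6 : HasFDerivAt (fun z => (φ t z).1) _ (x, v) := (hφ.hasFDerivAt_apply hk t (x, v)).fst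
    have h7 : HasFDerivAt (fun z => (φ t z).1) (ContinuousLinearMap.fst ℝ (E n) (E n) +
        t • fderiv ℝ (meanVel φ t) (x, v)) (x, v) := by
      simp_rw [hφ.fst_eq hk t]
      exact hasFDerivAt_fst.add (h4.differentiableAt.hasFDerivAt.const_smul t)
    have h8 := congrArg (fun A => A (0, w)) (h6.unique h7)
    simpa [h5] using h8

theorem exists_local_meanExp (hφ : IsELFlow n k L φ) (hnc : NoConjugatePoints n φ) (hk : 2 ≤ k)
    (p : ℝ × (E n × E n)) : ∃ e : OpenPartialHomeomorph (ℝ × (E n × E n)) (ℝ × (E n × E n)),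
      ⇑e = meanExp φ ∧ p ∈ e.source ∧ ContDiffAt ℝ 1 e.symm (meanExp φ p) :=
  exists_openPartialHomeomorph_of_injective_fderiv (hφ.contDiff_meanExp hk) p
    (hφ.fderiv_meanExp_injective hnc hk p)

theorem isLocalHomeomorph_meanExp (hφ : IsELFlow n k L φ) (hnc : NoConjugatePoints n φ)
    (hk : 2 ≤ k) : IsLocalHomeomorph (meanExp φ) :=
  .mk _ fun p => by
    obtain ⟨e, he, hp, -⟩ := hφ.exists_local_meanExp hnc hk p
    exact ⟨e, hp, he ▸ fun _ _ => rfl⟩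

theorem differentiableAt_of_isMeanLift (hφ : IsELFlow n k L φ) (hnc : NoConjugatePoints n φ)
    (hk : 2 ≤ k) {x : E n} {g u : ℝ → E n} (hg : Differentiable ℝ g) {t s : ℝ}
    (hu : IsMeanLift φ x g u t) (hs : s ∈ Ioo 0 t) : DifferentiableAt ℝ u s := by
  obtain ⟨e, he, hp, hes⟩ := hφ.exists_local_meanExp hnc hk (s, (x, u s))
  have hnhds : Icc 0 t ∈ 𝓝 s := Icc_mem_nhds hs.1 hs.2
  have hcont : ContinuousAt u s := hu.continuousOn.continuousAt hnhds
  have hcont' : ContinuousAt (fun r => (r, (x, u r))) s :=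
    continuousAt_id.prodMk (continuousAt_const.prodMk hcont)
  have h1 : ∀ᶠ r in 𝓝 s, (r, (x, u r)) ∈ e.source :=
    hcont'.eventually_mem (e.open_source.mem_nhds hp)
  have h2 : u =ᶠ[𝓝 s] fun r => (e.symm (r, (x, g r))).2.2 := by
    filter_upwards [h1, hnhds] with r hr hr'
    have := e.left_inv hr
    rw [he, meanExp, hu.eq r hr'] at this
    rw [this]
  rw [h2.differentiableAt_iff]
  have h3 : meanExp φ (s, (x, u s)) = (s, (x, g s)) := by
    rw [meanExp, hu.eq s (Ioo_subset_Icc_self hs)]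
  rw [h3] at hes
  have h4 : DifferentiableAt ℝ (fun r => e.symm (r, (x, g r))) s :=
    (hes.differentiableAt one_ne_zero).comp s
      (differentiableAt_id.prodMk ((differentiableAt_const x).prodMk (hg s)))
  exact h4.snd.snd

theorem action_le_of_isMeanLift (hφ : IsELFlow n k L φ) (hL : IsTonelliLagrangian n (k : ℕ∞) L)
    (hnc : NoConjugatePoints n φ) (hk : 2 ≤ k) {x : E n} {g u : ℝ → E n}
    (hg : Differentiable ℝ g) {t C : ℝ} (ht : 0 ≤ t) (hu : IsMeanLift φ x g u t)
    (hC : ∀ s ∈ Icc 0 t, L (x + s • g s, g s + s • deriv g s) ≤ C) :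
    action L φ t (x, u t) ≤ C * t := by
  let a : ℝ → ℝ := fun s => action L φ s (x, u s) - C * s
  have hcont : ContinuousOn a (Icc 0 t) :=
    ((hφ.contDiff_action hL hk).continuous.comp_continuousOn
      (continuousOn_id.prodMk (continuousOn_const.prodMk hu.continuousOn))).sub
      (continuous_const.mul continuous_id).continuousOn
  have hderiv : ∀ s ∈ Ioo 0 t, ∃ a', HasDerivAt a a' s ∧ a' ≤ 0 := by
    intro s hs
    have hud := (hφ.differentiableAt_of_isMeanLift hnc hk hg hu hs).hasDerivAt
    have hζ : HasDerivAt (fun r => (x, u r)) (0, deriv u s) s := (hasDerivAt_const s x).prodMk hud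
    have hev : (fun r => (φ r (x, u r)).1) =ᶠ[𝓝 s] fun r => x + r • g r := by
      filter_upwards [Icc_mem_nhds hs.1 hs.2] with r hr
      rw [hφ.fst_eq hk, hu.eq r hr]
    have hy : HasDerivAt (fun r => (φ r (x, u r)).1) (g s + s • deriv g s) s := by
      refine HasDerivAt.congr_of_eventuallyEq ?_ hev
      simpa [add_comm] using ((hasDerivAt_id s).smul (hg s).hasDerivAt).const_add x
    obtain ⟨a', ha', hle⟩ := hφ.exists_hasDerivAt_action_le hL hk hζ rfl hy
    have hev' : (φ s (x, u s)).1 = x + s • g s := hev.self_of_nhds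
    rw [hev'] at hle
    have := hC s (Ioo_subset_Icc_self hs)
    exact ⟨_, ha'.sub ((hasDerivAt_id s).const_mul C), by linarith⟩
  have hanti : AntitoneOn a (Icc 0 t) := by
    refine antitoneOn_of_deriv_nonpos (convex_Icc 0 t) hcont ?_ ?_
    · rw [interior_Icc]
      intro s hs
      obtain ⟨a', ha', -⟩ := hderiv s hs
      exact ha'.differentiableAt.differentiableWithinAt
    · rw [interior_Icc]
      intro s hs
      obtain ⟨a', ha', hle⟩ := hderiv s hs
      rwa [ha'.deriv]
  have := hanti (left_mem_Icc.2 ht) (right_mem_Icc.2 ht) ht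
  simp only [a, action, intervalIntegral.integral_same] at this
  rw [action]
  linarith

theorem exists_norm_le_of_isMeanLift (hφ : IsELFlow n k L φ)
    (hL : IsTonelliLagrangian n (k : ℕ∞) L) (hnc : NoConjugatePoints n φ) (hk : 2 ≤ k) (x : E n)
    {g : ℝ → E n} (hg : ContDiff ℝ 1 g) (T : ℝ) :
    ∃ R, ∀ t u, 0 ≤ t → t ≤ T → IsMeanLift φ x g u t → ‖u t‖ ≤ R := by
  have hcont : Continuous fun s : ℝ => L (x + s • g s, g s + s • deriv g s) := by
    have h1 := hg.continuous
    have h2 := hg.continuous_deriv le_rfl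
    exact (hL.contDiff_two hk).continuous.comp (by fun_prop)
  obtain ⟨C, hC⟩ := (isCompact_Icc (a := 0) (b := T)).bddAbove_image hcont.continuousOn
  obtain ⟨R, hR⟩ := hφ.exists_norm_le_of_action_le hL hk T C
  refine ⟨max R ‖g 0‖, fun t u ht htT hu => ?_⟩
  rcases ht.eq_or_lt with rfl | ht'
  · rw [hu.zero]
    exact le_max_right _ _
  · refine le_max_of_le_left (hR t (x, u t) ht' htT ?_)
    exact hφ.action_le_of_isMeanLift hL hnc hk (hg.differentiable one_ne_zero) ht hu
      fun s hs => hC (mem_image_of_mem _ ⟨hs.1, hs.2.trans htT⟩)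

theorem exists_isMeanLift_extend (hφ : IsELFlow n k L φ) (hnc : NoConjugatePoints n φ)
    (hk : 2 ≤ k) {x : E n} {g : ℝ → E n} (hg : Continuous g) {t₀ : ℝ} {v₀ : E n}
    (h₀ : meanVel φ t₀ (x, v₀) = g t₀) :
    ∃ ε > 0, ∃ O ∈ 𝓝 (t₀, v₀), ∀ t t' u, 0 ≤ t → t ∈ Ioo (t₀ - ε) (t₀ + ε) →
      t' ∈ Ioo (t₀ - ε) (t₀ + ε) → t ≤ t' → (t, u t) ∈ O → IsMeanLift φ x g u t →
      ∃ u', IsMeanLift φ x g u' t' := by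
  obtain ⟨e, he, hp, -⟩ := hφ.exists_local_meanExp hnc hk (t₀, (x, v₀))
  have hgc : Continuous fun t => (t, (x, g t)) := by fun_prop
  have h1 : ∀ᶠ t in 𝓝 t₀, (t, (x, g t)) ∈ e.target := by
    refine hgc.continuousAt.eventually_mem (e.open_target.mem_nhds ?_)
    have := e.map_source hp
    rwa [he, meanExp, h₀] at this
  obtain ⟨ε, hε, hball⟩ := Metric.eventually_nhds_iff_ball.1 h1
  rw [Real.ball_eq_Ioo] at hball
  have h2 : ∀ᶠ q : ℝ × E n in 𝓝 (t₀, v₀), (q.1, (x, q.2)) ∈ e.source :=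
    ContinuousAt.eventually_mem (by fun_prop) (e.open_source.mem_nhds hp)
  refine ⟨ε, hε, _, h2, fun t t' u ht htm htm' htt' hO hu => ?_⟩
  let σ : ℝ → E n := fun s => (e.symm (s, (x, g s))).2.2
  have hσ : ∀ s ∈ Ioo (t₀ - ε) (t₀ + ε), e.symm (s, (x, g s)) = (s, (x, σ s)) ∧
      meanVel φ s (x, σ s) = g s := by
    intro s hs
    have h3 := e.right_inv (hball s hs)
    rw [he, meanExp] at h3
    obtain ⟨h4, h5⟩ := Prod.mk.inj h3
    obtain ⟨h5, h6⟩ := Prod.mk.inj h5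
    have h7 : e.symm (s, (x, g s)) = (s, (x, σ s)) := Prod.ext h4 (Prod.ext h5 rfl)
    rw [h7] at h6
    exact ⟨h7, h6⟩
  have hσt : σ t = u t := by
    have h3 := e.left_inv hO
    rw [he, meanExp, hu.eq t (right_mem_Icc.2 ht), (hσ t htm).1] at h3
    exact (Prod.mk.inj (Prod.mk.inj h3).2).2
  have hσc : ContinuousOn σ (Icc t t') := by
    have : ContinuousOn (fun s => e.symm (s, (x, g s))) (Icc t t') :=
      e.continuousOn_symm.comp hgc.continuousOn fun s hs =>
        hball s ⟨htm.1.trans_le hs.1, hs.2.trans_lt htm'.2⟩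
    exact this.snd.snd
  let u' : ℝ → E n := fun s => if s ≤ t then u s else σ s
  have hu1 : EqOn u' u (Icc 0 t) := fun s hs => if_pos hs.2
  have hu2 : EqOn u' σ (Icc t t') := fun s hs => by
    rcases hs.1.eq_or_lt with rfl | h
    · exact (if_pos le_rfl).trans hσt.symm
    · exact if_neg h.not_ge
  refine ⟨u', ?_, ?_, fun s hs => ?_⟩
  · rw [← Icc_union_Icc_eq_Icc ht htt']
    exact (hu.continuousOn.congr hu1).union_of_isClosed (hσc.congr hu2) isClosed_Icc isClosed_Icc
  · rw [hu1 (left_mem_Icc.2 ht), hu.zero]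
  · rcases le_total s t with h | h
    · rw [hu1 ⟨hs.1, h⟩]
      exact hu.eq s ⟨hs.1, h⟩
    · rw [hu2 ⟨h, hs.2⟩]
      exact (hσ s ⟨htm.1.trans_le h, hs.2.trans_lt htm'.2⟩).2

theorem exists_isMeanLift (hφ : IsELFlow n k L φ) (hL : IsTonelliLagrangian n (k : ℕ∞) L)
    (hnc : NoConjugatePoints n φ) (hk : 2 ≤ k) (x : E n) {g : ℝ → E n} (hg : ContDiff ℝ 1 g)
    {T : ℝ} (hT : 0 ≤ T) : ∃ u, IsMeanLift φ x g u T := by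
  obtain ⟨R, hR⟩ := hφ.exists_norm_le_of_isMeanLift hL hnc hk x hg T
  let S : Set ℝ := {t | t ∈ Icc 0 T ∧ ∃ u, IsMeanLift φ x g u t}
  have h0 : (0 : ℝ) ∈ S := by
    refine ⟨left_mem_Icc.2 hT, g, hg.continuous.continuousOn, rfl, fun s hs => ?_⟩
    obtain rfl : s = 0 := le_antisymm hs.2 hs.1
    exact hφ.meanVel_zero _
  have hbdd : BddAbove S := ⟨T, fun t ht => ht.1.2⟩
  obtain ⟨t, -, htlim, htS⟩ := exists_seq_tendsto_sSup ⟨0, h0⟩ hbdd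
  choose u hu using fun i => (htS i).2
  obtain ⟨v₀, -, ψ, hψ, hv⟩ := (isCompact_closedBall (0 : E n) R).tendsto_subseq
    (x := fun i => u i (t i))
    fun i => mem_closedBall_zero_iff.2 (hR _ _ (htS i).1.1 (htS i).1.2 (hu i))
  have htψ : Tendsto (fun i => t (ψ i)) atTop (𝓝 (sSup S)) := htlim.comp hψ.tendsto_atTop
  have hlim : Tendsto (fun i => (t (ψ i), u (ψ i) (t (ψ i)))) atTop (𝓝 (sSup S, v₀)) :=
    htψ.prodMk_nhds hv
  have h₀ : meanVel φ (sSup S) (x, v₀) = g (sSup S) := by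
    have hc : Continuous fun q : ℝ × E n => meanVel φ q.1 (x, q.2) :=
      (hφ.contDiff_meanVel hk).continuous.comp
        (continuous_fst.prodMk (continuous_const.prodMk continuous_snd))
    refine tendsto_nhds_unique ((hc.tendsto _).comp hlim) ?_
    refine ((hg.continuous.tendsto _).comp htψ).congr fun i => ?_
    exact ((hu (ψ i)).eq _ (right_mem_Icc.2 (htS (ψ i)).1.1)).symm
  obtain ⟨ε, hε, O, hO, hext⟩ := hφ.exists_isMeanLift_extend hnc hk hg.continuous h₀
  have hev1 := hlim.eventually_mem hO
  have hev2 := htψ.eventually_mem (Ioo_mem_nhds (sub_lt_self (sSup S) hε) (lt_add_of_pos_right _ hε))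
  obtain ⟨i, hi1, hi2⟩ := (hev1.and hev2).exists
  have hsup0 : 0 ≤ sSup S := le_csSup hbdd h0
  have hsupT : sSup S ≤ T := csSup_le ⟨0, h0⟩ fun t ht => ht.1.2
  have hle : t (ψ i) ≤ sSup S := le_csSup hbdd (htS _)
  have hmin : sSup S ≤ min T (sSup S + ε / 2) := le_min hsupT (by linarith)
  have hmem : min T (sSup S + ε / 2) ∈ S := by
    refine ⟨⟨hsup0.trans hmin, min_le_left _ _⟩, ?_⟩
    refine hext _ _ _ (htS (ψ i)).1.1 hi2 ⟨by linarith, ?_⟩ (hle.trans hmin) hi1 (hu _)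
    exact (min_le_right _ _).trans_lt (by linarith)
  have hTmem : min T (sSup S + ε / 2) = T := by
    refine min_eq_left ?_
    by_contra! hcon
    have h3 := le_csSup hbdd hmem
    rw [min_eq_right hcon.le] at h3
    linarith
  rw [hTmem] at hmem
  exact hmem.2

theorem meanVel_surjective (hφ : IsELFlow n k L φ) (hL : IsTonelliLagrangian n (k : ℕ∞) L)
    (hnc : NoConjugatePoints n φ) (hk : 2 ≤ k) (x : E n) {T : ℝ} (hT : 0 ≤ T) :
    Function.Surjective fun v => meanVel φ T (x, v) := fun w => by
  obtain ⟨u, hu⟩ := hφ.exists_isMeanLift hL hnc hk x (contDiff_const (c := w)) hT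
  exact ⟨u T, hu.eq T (right_mem_Icc.2 hT)⟩

open unitInterval in
theorem meanVel_injective (hφ : IsELFlow n k L φ) (hL : IsTonelliLagrangian n (k : ℕ∞) L)
    (hnc : NoConjugatePoints n φ) (hk : 2 ≤ k) (x : E n) {T : ℝ} (hT : 0 ≤ T) :
    Function.Injective fun v => meanVel φ T (x, v) := by
  intro v₀ v₁ hv
  have hm : ∀ v, ContDiff ℝ 1 fun t => meanVel φ t (x, v) := fun v =>
    (hφ.contDiff_meanVel hk).comp (contDiff_prodMk_left (x, v))
  let g : I → ℝ → E n := fun s t =>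
    (1 - (s : ℝ)) • meanVel φ t (x, v₀) + (s : ℝ) • meanVel φ t (x, v₁)
  have hg : ∀ s, ContDiff ℝ 1 (g s) := fun s => by
    have h0 := hm v₀
    have h1 := hm v₁
    simp only [g]
    fun_prop
  choose u hu using fun s => hφ.exists_isMeanLift hL hnc hk x (hg s) hT
  have hmem : ∀ τ : I, T * (τ : ℝ) ∈ Icc 0 T := fun τ =>
    ⟨mul_nonneg hT τ.2.1, mul_le_of_le_one_right hT τ.2.2⟩
  have hloc := hφ.isLocalHomeomorph_meanExp hnc hk
  have hsep : IsSeparatedMap (meanExp φ) := T2Space.isSeparatedMap _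
  let f : C(I × I, ℝ × (E n × E n)) :=
    ⟨fun q => (T * (q.1 : ℝ), (x, g q.2 (T * (q.1 : ℝ)))), by
      have h0 := (hm v₀).continuous
      have h1 := (hm v₁).continuous
      simp only [g]
      fun_prop⟩
  let G : I × I → ℝ × (E n × E n) := fun q => (T * (q.1 : ℝ), (x, u q.2 (T * (q.1 : ℝ))))
  have hGf : meanExp φ ∘ G = f := by
    funext q
    simp only [Function.comp_apply, G, meanExp, (hu q.2).eq _ (hmem q.1)]
    rfl
  have hGA : ∀ s, Continuous fun τ => G (τ, s) := fun s => by
    have : Continuous fun τ : I => u s (T * (τ : ℝ)) :=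
      (hu s).continuousOn.comp_continuous (by fun_prop) hmem
    have hT : Continuous fun τ : I => T * (τ : ℝ) := by fun_prop
    exact hT.prodMk (continuous_const.prodMk this)
  have hG : Continuous G := by
    refine hloc.continuous_lift hsep f hGf ?_ hGA
    simp only [G, Icc.coe_zero, mul_zero, (hu _).zero, g, hφ.meanVel_zero]
    fun_prop
  have hend : ∀ (s : I) (v : E n), (∀ t, g s t = meanVel φ t (x, v)) → G (1, s) = (T, (x, v)) := by
    intro s v hsv
    have heq := hsep.eq_of_comp_eq hloc.isLocallyInjective (A := I) (g₁ := fun τ => G (τ, s))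
      (g₂ := fun τ : I => (T * (τ : ℝ), (x, v))) (hGA s) (by fun_prop) ?_ 0 ?_
    · simpa using congrFun heq 1
    · funext τ
      rw [Function.comp_apply, show meanExp φ (G (τ, s)) = _ from congrFun hGf (τ, s)]
      simp [f, hsv, meanExp]
    · simp only [G, Icc.coe_zero, mul_zero, (hu _).zero, hsv, hφ.meanVel_zero]
  have hconst := hsep.const_of_comp hloc.isLocallyInjective (A := I) (g := fun s => G (1, s))
    (hG.comp (by fun_prop)) (fun s s' => by
      rw [show meanExp φ (G (1, s)) = _ from congrFun hGf (1, s),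
        show meanExp φ (G (1, s')) = _ from congrFun hGf (1, s')]
      simp only at hv
      simp [f, g, hv, ← add_smul]) 0 1
  rw [hend 0 v₀ (by simp [g]), hend 1 v₁ (by simp [g])] at hconst
  exact (Prod.mk.inj (Prod.mk.inj hconst).2).2

end IsELFlow

/-- An initial velocity at `x` of an orbit reaching `y` at time `t`, where `p = (t, x, y)`. -/
def velTo (φ : ℝ → E n × E n → E n × E n) (p : ℝ × (E n × E n)) : E n :=
  Function.invFun (fun v => (φ p.1 (p.2.1, v)).1) p.2.2

/-- The action of the orbit joining `x` to `y` in time `t`, where `p = (t, x, y)`. -/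
def orbitCost (L : E n × E n → ℝ) (φ : ℝ → E n × E n → E n × E n) (p : ℝ × (E n × E n)) : ℝ :=
  action L φ p.1 (p.2.1, velTo φ p)

theorem intVec_add (m m' : Fin n → ℤ) : intVec (m + m') = intVec m + intVec m' := by
  ext i
  simp [intVec]

theorem intVec_zero : intVec (0 : Fin n → ℤ) = 0 := by
  ext i
  simp [intVec]

theorem intVec_neg (m : Fin n → ℤ) : intVec (-m) = -intVec m := by
  ext i
  simp [intVec]

/-- A continuous `ℤⁿ`-periodic function attains its maximum. -/
theorem exists_forall_le_of_periodic {f : E n → ℝ} (hf : Continuous f)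
    (hper : ∀ x m, f (x + intVec m) = f x) : ∃ x, ∀ y, f y ≤ f x := by
  obtain ⟨x, -, hx⟩ := (isCompact_Icc (a := (0 : E n)) (b := 1)).exists_isMaxOn
    ⟨0, left_mem_Icc.2 zero_le_one⟩ hf.continuousOn
  refine ⟨x, fun y => ?_⟩
  rw [← hper y fun i => -⌊y i⌋]
  refine hx ⟨fun i => ?_, fun i => ?_⟩
  · have := Int.floor_le (y i)
    simp only [Pi.zero_apply, Pi.add_apply, intVec]
    push_cast
    linarith
  · have := Int.lt_floor_add_one (y i)
    simp only [Pi.one_apply, Pi.add_apply, intVec]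
    push_cast
    linarith

namespace IsELFlow

theorem bijective_fst_apply (hφ : IsELFlow n k L φ) (hL : IsTonelliLagrangian n (k : ℕ∞) L)
    (hnc : NoConjugatePoints n φ) (hk : 2 ≤ k) (x : E n) {t : ℝ} (ht : 0 < t) :
    Function.Bijective fun v => (φ t (x, v)).1 := by
  simp_rw [hφ.fst_eq hk]
  refine ⟨fun v w h => hφ.meanVel_injective hL hnc hk x ht.le ?_, fun y => ?_⟩
  · exact smul_right_injective _ ht.ne' (add_left_cancel h)
  · obtain ⟨v, hv⟩ := hφ.meanVel_surjective hL hnc hk x ht.le (t⁻¹ • (y - x))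
    refine ⟨v, ?_⟩
    simp only at hv ⊢
    rw [hv, smul_inv_smul₀ ht.ne', add_sub_cancel]

theorem fst_apply_velTo (hφ : IsELFlow n k L φ) (hL : IsTonelliLagrangian n (k : ℕ∞) L)
    (hnc : NoConjugatePoints n φ) (hk : 2 ≤ k) {t : ℝ} (ht : 0 < t) (x y : E n) :
    (φ t (x, velTo φ (t, (x, y)))).1 = y :=
  Function.invFun_eq ((hφ.bijective_fst_apply hL hnc hk x ht).2 y)

theorem velTo_eq (hφ : IsELFlow n k L φ) (hL : IsTonelliLagrangian n (k : ℕ∞) L)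
    (hnc : NoConjugatePoints n φ) (hk : 2 ≤ k) {t : ℝ} (ht : 0 < t) {x y v : E n}
    (h : (φ t (x, v)).1 = y) : velTo φ (t, (x, y)) = v :=
  (hφ.bijective_fst_apply hL hnc hk x ht).1 ((hφ.fst_apply_velTo hL hnc hk ht x y).trans h.symm)

theorem meanVel_velTo (hφ : IsELFlow n k L φ) (hL : IsTonelliLagrangian n (k : ℕ∞) L)
    (hnc : NoConjugatePoints n φ) (hk : 2 ≤ k) {p : ℝ × (E n × E n)} (hp : 0 < p.1) :
    meanVel φ p.1 (p.2.1, velTo φ p) = p.1⁻¹ • (p.2.2 - p.2.1) := by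
  have := hφ.fst_apply_velTo hL hnc hk hp p.2.1 p.2.2
  rw [hφ.fst_eq hk] at this
  rw [← this, add_sub_cancel_left, inv_smul_smul₀ hp.ne']

theorem differentiableAt_velTo (hφ : IsELFlow n k L φ) (hL : IsTonelliLagrangian n (k : ℕ∞) L)
    (hnc : NoConjugatePoints n φ) (hk : 2 ≤ k) {p : ℝ × (E n × E n)} (hp : 0 < p.1) :
    DifferentiableAt ℝ (velTo φ) p := by
  let q : ℝ × (E n × E n) → ℝ × (E n × E n) := fun p => (p.1, (p.2.1, p.1⁻¹ • (p.2.2 - p.2.1)))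
  have hq : ∀ p : ℝ × (E n × E n), 0 < p.1 → meanExp φ (p.1, (p.2.1, velTo φ p)) = q p :=
    fun p hp => by simp only [meanExp, q, hφ.meanVel_velTo hL hnc hk hp]
  have hqd : DifferentiableAt ℝ q p := by
    have : DifferentiableAt ℝ (fun p : ℝ × (E n × E n) => p.1⁻¹) p :=
      differentiableAt_fst.inv hp.ne'
    simp only [q]
    fun_prop
  obtain ⟨e, he, hpe, hes⟩ := hφ.exists_local_meanExp hnc hk (p.1, (p.2.1, velTo φ p))
  rw [hq p hp] at hes
  have htarget : q p ∈ e.target := by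
    rw [← hq p hp, ← he]
    exact e.map_source hpe
  have hd : DifferentiableAt ℝ (fun p => (e.symm (q p)).2.2) p :=
    ((hes.differentiableAt one_ne_zero).comp p hqd).snd.snd
  refine hd.congr_of_eventuallyEq ?_
  filter_upwards [continuousAt_fst.eventually (lt_mem_nhds hp),
    hqd.continuousAt.eventually_mem (e.open_target.mem_nhds htarget)] with p' hp' hqp'
  have h1 := e.right_inv hqp'
  rw [he] at h1
  obtain ⟨h2, h3⟩ := Prod.mk.inj h1
  obtain ⟨h3, h4⟩ := Prod.mk.inj h3
  rw [h2] at h4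
  refine hφ.meanVel_injective hL hnc hk p'.2.1 hp'.le ?_
  simp only
  rw [hφ.meanVel_velTo hL hnc hk hp', ← h4, ← h3]

theorem differentiableAt_orbitCost (hφ : IsELFlow n k L φ)
    (hL : IsTonelliLagrangian n (k : ℕ∞) L) (hnc : NoConjugatePoints n φ) (hk : 2 ≤ k)
    {p : ℝ × (E n × E n)} (hp : 0 < p.1) : DifferentiableAt ℝ (orbitCost L φ) p := by
  have h1 := hφ.differentiableAt_velTo hL hnc hk hp
  exact ((hφ.contDiff_action hL hk).differentiable one_ne_zero _).comp p
    (f := fun p : ℝ × (E n × E n) => (p.1, (p.2.1, velTo φ p))) (by fun_prop)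

theorem orbitCost_eq (hφ : IsELFlow n k L φ) (hL : IsTonelliLagrangian n (k : ℕ∞) L)
    (hnc : NoConjugatePoints n φ) (hk : 2 ≤ k) {t : ℝ} (ht : 0 < t) {x y v : E n}
    (h : (φ t (x, v)).1 = y) : orbitCost L φ (t, (x, y)) = action L φ t (x, v) := by
  rw [orbitCost, hφ.velTo_eq hL hnc hk ht h]

theorem action_add_intVec (hφ : IsELFlow n k L φ) (hL : IsTonelliLagrangian n (k : ℕ∞) L)
    (hk : 2 ≤ k) (t : ℝ) (x v : E n) (m : Fin n → ℤ) :
    action L φ t (x + intVec m, v) = action L φ t (x, v) := by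
  simp only [action, hφ.apply_add_intVec hL hk, hL.periodic]

theorem orbitCost_add_intVec (hφ : IsELFlow n k L φ) (hL : IsTonelliLagrangian n (k : ℕ∞) L)
    (hnc : NoConjugatePoints n φ) (hk : 2 ≤ k) {t : ℝ} (ht : 0 < t) (x y : E n)
    (m : Fin n → ℤ) :
    orbitCost L φ (t, (x + intVec m, y + intVec m)) = orbitCost L φ (t, (x, y)) := by
  have h : (φ t (x + intVec m, velTo φ (t, (x, y)))).1 = y + intVec m := by
    rw [hφ.apply_add_intVec hL hk, hφ.fst_apply_velTo hL hnc hk ht]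
  rw [hφ.orbitCost_eq hL hnc hk ht h, hφ.action_add_intVec hL hk, orbitCost]

theorem action_add (hφ : IsELFlow n k L φ) (hL : IsTonelliLagrangian n (k : ℕ∞) L)
    (hk : 2 ≤ k) (s t : ℝ) (z : E n × E n) :
    action L φ (s + t) z = action L φ s z + action L φ t (φ s z) := by
  have hc := hφ.continuous_lagrangian_orbit hL hk z
  simp only [action, hφ.apply_apply hL hk]
  rw [intervalIntegral.integral_comp_add_right (fun r => L (φ r z)), zero_add, add_comm t s,
    intervalIntegral.integral_add_adjacent_intervals (hc.intervalIntegrable _ _)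
      (hc.intervalIntegrable _ _)]

theorem orbitCost_triangle (hφ : IsELFlow n k L φ) (hL : IsTonelliLagrangian n (k : ℕ∞) L)
    (hnc : NoConjugatePoints n φ) (hk : 2 ≤ k) {s t : ℝ} (hs : 0 < s) (ht : 0 < t)
    (x y z : E n) :
    orbitCost L φ (s + t, (x, z)) ≤ orbitCost L φ (s, (x, y)) + orbitCost L φ (t, (y, z)) := by
  set v := velTo φ (t, (y, z)) with hv
  let η : ℝ → E n := fun r => (φ (r - s) (y, v)).1
  have hη : ∀ r, HasDerivAt η (φ (r - s) (y, v)).2 r := fun r =>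
    (hφ.hasDerivAt_fst (y, v) (r - s)).comp_sub_const r s
  have hηs : η s = y := by simp [η, hφ.2.1]
  have hηt : η (s + t) = z := by
    simp only [η, add_sub_cancel_left, hv, hφ.fst_apply_velTo hL hnc hk ht]
  let u : ℝ → E n := fun r => velTo φ (r, (x, η r))
  have hud : ∀ r, 0 < r → HasDerivAt u (deriv u r) r := fun r hr =>
    DifferentiableAt.hasDerivAt (DifferentiableAt.comp r (hφ.differentiableAt_velTo hL hnc hk hr)
      (differentiableAt_id.prodMk ((differentiableAt_const x).prodMk (hη r).differentiableAt)))
  let a : ℝ → ℝ := fun r => orbitCost L φ (r, (x, η r)) - action L φ (r - s) (y, v)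
  have hderiv : ∀ r, 0 < r → ∃ a', HasDerivAt a a' r ∧ a' ≤ 0 := by
    intro r hr
    have hζ : HasDerivAt (fun r => (x, u r)) (0, deriv u r) r :=
      (hasDerivAt_const r x).prodMk (hud r hr)
    have hev : (fun r => (φ r (x, u r)).1) =ᶠ[𝓝 r] η := by
      filter_upwards [lt_mem_nhds hr] with r' hr'
      exact hφ.fst_apply_velTo hL hnc hk hr' x (η r')
    obtain ⟨a', ha', hle⟩ := hφ.exists_hasDerivAt_action_le hL hk hζ rfl
      ((hη r).congr_of_eventuallyEq hev)
    rw [show (φ r (x, u r)).1 = η r from hev.self_of_nhds] at hle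
    have h1 : HasDerivAt (fun r => action L φ r (y, v)) (L (φ (r - s) (y, v))) (r - s) :=
      ((hφ.continuous_lagrangian_orbit hL hk (y, v)).integral_hasStrictDerivAt 0 _).hasDerivAt
    exact ⟨_, ha'.sub (h1.comp_sub_const r s), sub_nonpos.2 hle⟩
  have hanti : AntitoneOn a (Icc s (s + t)) := by
    refine antitoneOn_of_deriv_nonpos (convex_Icc _ _) (fun r hr => ?_) (fun r hr => ?_)
      fun r hr => ?_
    · obtain ⟨a', ha', -⟩ := hderiv r (hs.trans_le hr.1)
      exact ha'.continuousAt.continuousWithinAt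
    · obtain ⟨a', ha', -⟩ := hderiv r (hs.trans_le (interior_subset hr).1)
      exact ha'.differentiableAt.differentiableWithinAt
    · obtain ⟨a', ha', hle⟩ := hderiv r (hs.trans_le (interior_subset hr).1)
      rwa [ha'.deriv]
  have := hanti (left_mem_Icc.2 (by linarith)) (right_mem_Icc.2 (by linarith)) (by linarith)
  simp only [a, hηs, hηt, sub_self, add_sub_cancel_left] at this
  rw [show action L φ 0 (y, v) = 0 from intervalIntegral.integral_same] at this
  rw [show orbitCost L φ (t, (y, z)) = action L φ t (y, v) from rfl]
  linarith

/-- A maximum of the cost of the loops in the class `r` is the base point of a periodic orbit. -/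
theorem apply_velTo_of_isMax (hφ : IsELFlow n k L φ) (hL : IsTonelliLagrangian n (k : ℕ∞) L)
    (hnc : NoConjugatePoints n φ) (hk : 2 ≤ k) {T : ℝ} (hT : 0 < T) (r : Fin n → ℤ) {z : E n}
    (hz : ∀ w, orbitCost L φ (T, (w, w + intVec r)) ≤ orbitCost L φ (T, (z, z + intVec r))) :
    φ T (z, velTo φ (T, (z, z + intVec r))) =
      (z + intVec r, velTo φ (T, (z, z + intVec r))) := by
  let u : E n → E n := fun w => velTo φ (T, (w, w + intVec r))
  change φ T (z, u z) = (z + intVec r, u z)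
  have hu : DifferentiableAt ℝ u z := by
    have := hφ.differentiableAt_velTo hL hnc hk (p := (T, (z, z + intVec r))) hT
    exact this.comp z (f := fun w => (T, (w, w + intVec r))) (by fun_prop)
  have hend : ∀ w, (φ T (w, u w)).1 = w + intVec r := fun w =>
    hφ.fst_apply_velTo hL hnc hk hT w _
  have hpair : HasFDerivAt (fun w => (w, u w))
      ((ContinuousLinearMap.id ℝ (E n)).prod (fderiv ℝ u z)) z :=
    (hasFDerivAt_id z).prodMk hu.hasFDerivAt
  have hact : HasFDerivAt (action L φ T) (fderiv ℝ (action L φ T) (z, u z)) (z, u z) :=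
    (((hφ.contDiff_action hL hk).comp (contDiff_prodMk_right T)).differentiable
      one_ne_zero _).hasFDerivAt
  have h1 : HasFDerivAt (fun w => action L φ T (w, u w)) _ z :=
    HasFDerivAt.comp (g := action L φ T) (f := fun w => (w, u w)) z hact hpair
  have hmax : IsLocalMax (fun w => action L φ T (w, u w)) z := Eventually.of_forall hz
  have h2 := hmax.hasFDerivAt_eq_zero h1
  have h3 : HasFDerivAt (fun w => (φ T (w, u w)).1) _ z :=
    HasFDerivAt.comp (g := fun p => (φ T p).1) (f := fun w => (w, u w)) z
      (hφ.hasFDerivAt_apply hk T (z, u z)).fst hpair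
  have h4 : HasFDerivAt (fun w => (φ T (w, u w)).1) (ContinuousLinearMap.id ℝ (E n)) z := by
    simp_rw [hend]
    exact (hasFDerivAt_id z).add_const _
  refine Prod.ext (hend z) (hL.partialV_injective hk z ?_)
  ext ξ
  have h5 := congrArg (fun A => A ξ) h2
  have h6 := congrArg (fun A => A ξ) (h3.unique h4)
  simp only [ContinuousLinearMap.comp_apply, ContinuousLinearMap.prod_apply,
    ContinuousLinearMap.id_apply, _root_.zero_apply,
    ContinuousLinearMap.coe_fst'] at h5 h6
  rw [hφ.fderiv_action hL hk, h6, hend, hL.partialV_add_intVec] at h5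
  exact sub_eq_zero.1 h5

theorem orbitCost_nsmul (hφ : IsELFlow n k L φ) (hL : IsTonelliLagrangian n (k : ℕ∞) L)
    (hnc : NoConjugatePoints n φ) (hk : 2 ≤ k) {T : ℝ} (hT : 0 < T) {r : Fin n → ℤ} {z v : E n}
    (h : φ T (z, v) = (z + intVec r, v)) (N : ℕ) (hN : 0 < N) :
    orbitCost L φ (N * T, (z, z + intVec (N • r))) = N * action L φ T (z, v) := by
  have key : ∀ N : ℕ, φ (N * T) (z, v) = (z + intVec (N • r), v) ∧
      action L φ (N * T) (z, v) = N * action L φ T (z, v) := by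
    intro N
    induction N with
    | zero => simp [hφ.2.1, intVec_zero, action]
    | succ N ih =>
      have hT' : ((N + 1 : ℕ) : ℝ) * T = N * T + T := by push_cast; ring
      constructor
      · rw [hT', add_comm, ← hφ.apply_apply hL hk, ih.1, hφ.apply_add_intVec hL hk, h, succ_nsmul',
          intVec_add, add_assoc]
      · rw [hT', hφ.action_add hL hk, ih.1, hφ.action_add_intVec hL hk, ih.2]
        push_cast
        ring
  rw [hφ.orbitCost_eq hL hnc hk (by positivity) (congrArg Prod.fst (key N).1), (key N).2]

theorem orbitCost_iterate_le (hφ : IsELFlow n k L φ) (hL : IsTonelliLagrangian n (k : ℕ∞) L)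
    (hnc : NoConjugatePoints n φ) (hk : 2 ≤ k) {T : ℝ} (hT : 0 < T) (r : Fin n → ℤ) (w z : E n)
    (N : ℕ) :
    orbitCost L φ ((N + 1 : ℕ) * T, (z, w + intVec ((N + 1) • r))) ≤
      orbitCost L φ (T, (z, w + intVec r)) + N * orbitCost L φ (T, (w, w + intVec r)) := by
  induction N with
  | zero => simp
  | succ N ih =>
    have h1 := hφ.orbitCost_triangle hL hnc hk (s := (N + 1 : ℕ) * T) (by positivity) hT z
      (w + intVec ((N + 1) • r)) (w + intVec ((N + 1 + 1) • r))
    have h2 : w + intVec ((N + 1 + 1) • r) = w + intVec r + intVec ((N + 1) • r) := by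
      rw [succ_nsmul', intVec_add, add_assoc]
    rw [h2, hφ.orbitCost_add_intVec hL hnc hk hT, ← h2] at h1
    rw [show ((N + 1 + 1 : ℕ) : ℝ) * T = (N + 1 : ℕ) * T + T by push_cast; ring]
    push_cast at *
    linarith

/-- The cost of the loops in the class `r` does not depend on the base point. -/
theorem orbitCost_loop_le (hφ : IsELFlow n k L φ) (hL : IsTonelliLagrangian n (k : ℕ∞) L)
    (hnc : NoConjugatePoints n φ) (hk : 2 ≤ k) {T : ℝ} (hT : 0 < T) (r : Fin n → ℤ) (z w : E n) :
    orbitCost L φ (T, (z, z + intVec r)) ≤ orbitCost L φ (T, (w, w + intVec r)) := by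
  have hdiff : Differentiable ℝ fun x => orbitCost L φ (T, (x, x + intVec r)) := fun x => by
    have := hφ.differentiableAt_orbitCost hL hnc hk (p := (T, (x, x + intVec r))) hT
    exact this.comp x (f := fun w => (T, (w, w + intVec r))) (by fun_prop)
  obtain ⟨x, hx⟩ := exists_forall_le_of_periodic hdiff.continuous fun x m => by
    rw [add_right_comm, hφ.orbitCost_add_intVec hL hnc hk hT]
  refine (hx z).trans ?_
  have hper := hφ.apply_velTo_of_isMax hL hnc hk hT r hx
  by_contra! hlt
  set A := orbitCost L φ (T, (x, x + intVec r)) with hA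
  set B := orbitCost L φ (T, (w, w + intVec r))
  set C := orbitCost L φ (T, (x, w + intVec r)) + orbitCost L φ (T, (w, x + intVec r))
  have key : ∀ N : ℕ, (N + 2) * A ≤ C + N * B := fun N => by
    have h1 := hφ.orbitCost_nsmul hL hnc hk hT hper (N + 1 + 1) (by omega)
    have h2 := hφ.orbitCost_triangle hL hnc hk (s := (N + 1 : ℕ) * T) (by positivity) hT x
      (w + intVec ((N + 1) • r)) (x + intVec ((N + 1 + 1) • r))
    have h3 : x + intVec ((N + 1 + 1) • r) = x + intVec r + intVec ((N + 1) • r) := by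
      rw [succ_nsmul', intVec_add, add_assoc]
    rw [h3, hφ.orbitCost_add_intVec hL hnc hk hT, ← h3,
      show ((N + 1 : ℕ) : ℝ) * T + T = (N + 1 + 1 : ℕ) * T by push_cast; ring, h1] at h2
    have h4 := hφ.orbitCost_iterate_le hL hnc hk hT r w x N
    change _ * A ≤ _ at h2
    push_cast at h2 h4
    linarith
  obtain ⟨N, hN⟩ := exists_nat_gt ((C - 2 * A) / (A - B))
  rw [div_lt_iff₀ (sub_pos.2 hlt)] at hN
  linarith [key N]

theorem periodic_of_isExtremal (hφ : IsELFlow n k L φ) (hL : IsTonelliLagrangian n (k : ℕ∞) L)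
    (hnc : NoConjugatePoints n φ) (hk : 2 ≤ k) {c : ℝ → E n} (hc : IsExtremal n L c) {a b : ℝ}
    {r : Fin n → ℤ} (hab : a < b) (h : c b = c a + intVec r) (s : ℝ) :
    c (s + (b - a)) = c s + intVec r := by
  have hT := sub_pos.2 hab
  have h1 := hφ.apply_of_isExtremal hL hk hc a (b - a)
  rw [sub_add_cancel, h] at h1
  have h2 := hφ.apply_velTo_of_isMax hL hnc hk hT r
    fun w => hφ.orbitCost_loop_le hL hnc hk hT r w (c a)
  rw [hφ.velTo_eq hL hnc hk hT (congrArg Prod.fst h1), h1] at h2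
  have h3 : deriv c b = deriv c a := (Prod.mk.inj h2).2
  refine congrFun (IsExtremal.eq_of_eq hL hk (hc.comp_add (b - a)) (hc.add_intVec hL r) a ?_ ?_) s
  · simpa using h
  · rw [deriv_comp_add_const, deriv_add_const, add_sub_cancel, h3]

end IsELFlow

end

/-- For a Tonelli Lagrangian without conjugate points, if an extremal
curve satisfies `c b = c a + r` with `a < b` and `r ∈ ℤⁿ`, then
`c (s + (b - a)) = c s + r` for all `s`; consequently the projection of every extremal
curve to `𝕋ⁿ = ℝⁿ/ℤⁿ` is either injective or periodic. -/
theorem extremal_injective_or_periodic (n k : ℕ) (hn : 1 ≤ n) (hk : 2 ≤ k)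
    (L : E n × E n → ℝ) (hL : IsTonelliLagrangian n (k : ℕ∞) L)
    (φ : ℝ → E n × E n → E n × E n) (hφ : IsELFlow n k L φ)
    (hnc : NoConjugatePoints n φ)
    (c : ℝ → E n) (hc : IsExtremal n L c) :
    (∀ (a b : ℝ) (r : Fin n → ℤ), a < b → c b = c a + intVec r →
      ∀ s : ℝ, c (s + (b - a)) = c s + intVec r) ∧
    ((∀ s s' : ℝ, (∃ m : Fin n → ℤ, c s' = c s + intVec m) → s = s') ∨
      (∃ p : ℝ, 0 < p ∧ ∃ m : Fin n → ℤ, ∀ s : ℝ, c (s + p) = c s + intVec m)) := by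
  have key : ∀ (a b : ℝ) (r : Fin n → ℤ), a < b → c b = c a + intVec r →
      ∀ s : ℝ, c (s + (b - a)) = c s + intVec r :=
    fun a b r hab h => hφ.periodic_of_isExtremal hL hnc hk hc hab h
  refine ⟨key, or_iff_not_imp_left.2 fun h => ?_⟩
  push Not at h
  obtain ⟨s, s', ⟨m, hm⟩, hne⟩ := h
  rcases hne.lt_or_gt with hlt | hlt
  · exact ⟨s' - s, sub_pos.2 hlt, m, key s s' m hlt hm⟩
  · refine ⟨s - s', sub_pos.2 hlt, -m, key s' s (-m) hlt ?_⟩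
    rw [hm, intVec_neg, add_neg_cancel_right]

end
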